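/- arXiv:2110.14691 — 3 statements merged into one kernel-verified Lean document; each statement's English description precedes it below -/
import Mathlib

section
/- Let M be a von Neumann algebra on a finite-dimensional complex Hilbert space H. Then there exist a finite index set, finite-dimensional complex Hilbert spaces H_{A_α} and H_{Ā_α}, and a unitary identification H ≅ ⊕_α (H_{A_α} ⊗ H_{Ā_α}) under which M = ⊕_α (L(H_{A_α}) ⊗ I_{Ā_α}), the commutant satisfies M' = ⊕_α (I_{A_α} ⊗ L(H_{Ā_α})), and the center satisfies Z_M = {⊕_α c_α (I_{A_α} ⊗ I_{Ā_α}) : c_α ∈ ℂ} (the Wedderburn decomposition). -/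
open Matrix Kronecker

/-- The commutant of a set of operators. -/
def commutant {ι : Type*} [Fintype ι] (M : Set (Matrix ι ι ℂ)) : Set (Matrix ι ι ℂ) :=
  {B | ∀ A ∈ M, A * B = B * A}

/-- A von Neumann algebra on a finite-dimensional complex Hilbert space. -/
structure IsVNAlgebra {ι : Type*} [Fintype ι] [DecidableEq ι]
    (M : Set (Matrix ι ι ℂ)) : Prop where
  add_mem : ∀ A ∈ M, ∀ B ∈ M, A + B ∈ M
  mul_mem : ∀ A ∈ M, ∀ B ∈ M, A * B ∈ M
  smul_mem : ∀ (c : ℂ), ∀ A ∈ M, c • A ∈ M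
  star_mem : ∀ A ∈ M, Aᴴ ∈ M
  one_mem : (1 : Matrix ι ι ℂ) ∈ M


namespace Wed

variable {ι : Type*} [Fintype ι] [DecidableEq ι]

section comm
variable {M : Set (Matrix ι ι ℂ)}

lemma comm_star (hM : IsVNAlgebra M) {B : Matrix ι ι ℂ} (hB : B ∈ commutant M) :
    Bᴴ ∈ commutant M := by
  intro A hA
  have := congrArg conjTranspose (hB _ (hM.star_mem A hA))
  simpa [conjTranspose_mul] using this.symm

lemma comm_mul {B C : Matrix ι ι ℂ} (hB : B ∈ commutant M) (hC : C ∈ commutant M) :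
    B * C ∈ commutant M := by
  intro A hA
  rw [← mul_assoc, hB A hA, mul_assoc, hC A hA, mul_assoc]

lemma comm_add {B C : Matrix ι ι ℂ} (hB : B ∈ commutant M) (hC : C ∈ commutant M) :
    B + C ∈ commutant M := by
  intro A hA
  rw [mul_add, add_mul, hB A hA, hC A hA]

lemma comm_sub {B C : Matrix ι ι ℂ} (hB : B ∈ commutant M) (hC : C ∈ commutant M) :
    B - C ∈ commutant M := by
  intro A hA
  rw [mul_sub, sub_mul, hB A hA, hC A hA]

lemma comm_smul {B : Matrix ι ι ℂ} (c : ℂ) (hB : B ∈ commutant M) :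
    c • B ∈ commutant M := by
  intro A hA
  rw [Matrix.mul_smul, Matrix.smul_mul, hB A hA]

lemma comm_one : (1 : Matrix ι ι ℂ) ∈ commutant M := by
  intro A hA
  simp
end comm

lemma single_left (T : Matrix ι ι ℂ) (i' j : ι) :
    T * Matrix.single i' j 1 = ∑ l, T l i' • Matrix.single l j (1 : ℂ) := by
  ext a b
  simp only [Matrix.sum_apply, Matrix.smul_apply, Matrix.single_apply, Matrix.mul_apply, smul_eq_mul]
  by_cases h : j = b <;> simp [h]

lemma lin_comm_iff (p : Matrix ι ι ℂ →ₗ[ℂ] Matrix ι ι ℂ) (T : Matrix ι ι ℂ) :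
    (∀ X, p (T * X) = T * p X) ↔
    ∀ j k, T * (Matrix.of fun i i' => p (Matrix.single i' j 1) i k) =
      (Matrix.of fun i i' => p (Matrix.single i' j 1) i k) * T := by
  have key : ∀ i' j i k, (p (T * Matrix.single i' j 1) i k = (T * p (Matrix.single i' j 1)) i k) ↔
      (T * (Matrix.of fun i i' => p (Matrix.single i' j 1) i k)) i i' =
      ((Matrix.of fun i i' => p (Matrix.single i' j 1) i k) * T) i i' := by
    intro i' j i k
    rw [single_left, map_sum]
    simp only [map_smul, Matrix.sum_apply, Matrix.smul_apply, Matrix.mul_apply, Matrix.of_apply,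
      smul_eq_mul]
    constructor
    · intro h
      rw [← h]
      exact Finset.sum_congr rfl fun _ _ => mul_comm _ _
    · intro h
      rw [h]
      exact Finset.sum_congr rfl fun _ _ => mul_comm _ _
  constructor
  · intro h j k
    ext i i'
    rw [← key, h]
  · intro h X
    have : p ∘ₗ LinearMap.mulLeft ℂ T = LinearMap.mulLeft ℂ T ∘ₗ p := by
      apply (Matrix.stdBasis ℂ ι ι).ext
      rintro ⟨i', j⟩
      rw [Matrix.stdBasis_eq_single]
      ext i k
      simp only [LinearMap.comp_apply, LinearMap.mulLeft_apply]
      rw [key, h]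
    exact LinearMap.congr_fun this X

/-- Double commutant theorem. -/
lemma bicomm {M : Set (Matrix ι ι ℂ)} (hM : IsVNAlgebra M) {T : Matrix ι ι ℂ}
    (hT : T ∈ commutant (commutant M)) : T ∈ M := by
  let e : Matrix ι ι ℂ ≃ₗ[ℂ] EuclideanSpace ℂ (ι × ι) :=
    (LinearEquiv.curry ℂ ℂ ι ι).symm.trans (WithLp.linearEquiv 2 ℂ (ι × ι → ℂ)).symm
  let K0 : Submodule ℂ (Matrix ι ι ℂ) :=
    { carrier := M
      add_mem' := fun {a b} ha hb => hM.add_mem a ha b hb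
      zero_mem' := by simpa using hM.smul_mem 0 1 hM.one_mem
      smul_mem' := fun c a ha => hM.smul_mem c a ha }
  let K : Submodule ℂ (EuclideanSpace ℂ (ι × ι)) := K0.map (e : _ →ₗ[ℂ] _)
  have hin : ∀ X Y : Matrix ι ι ℂ, inner ℂ (e X) (e Y) = (Xᴴ * Y).trace := by
    intro X Y
    simp only [PiLp.inner_apply, Fintype.sum_prod_type, Matrix.trace, Matrix.mul_apply, Matrix.diag]
    rw [Finset.sum_comm]
    refine Finset.sum_congr rfl fun i _ => Finset.sum_congr rfl fun j _ => ?_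
    change Y j i * star (X j i) = star (X j i) * Y j i
    exact mul_comm _ _
  have hK : ∀ X, e X ∈ K ↔ X ∈ M := by
    intro X
    constructor
    · rintro ⟨Y, hY, h⟩
      have : Y = X := e.injective h
      exact this ▸ hY
    · intro h
      exact ⟨X, h, rfl⟩
  let p : Matrix ι ι ℂ →ₗ[ℂ] Matrix ι ι ℂ :=
    (e.symm : _ →ₗ[ℂ] _) ∘ₗ (K.starProjection : EuclideanSpace ℂ (ι × ι) →ₗ[ℂ] EuclideanSpace ℂ (ι × ι)) ∘ₗ (e : Matrix ι ι ℂ →ₗ[ℂ] EuclideanSpace ℂ (ι × ι))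
  have hep : ∀ X, e (p X) = K.starProjection (e X) := fun X => by simp [p]
  have hpM : ∀ X, p X ∈ M := fun X => by
    rw [← hK, hep]; exact Submodule.starProjection_apply_mem _ _
  have hfix : ∀ X ∈ M, p X = X := fun X hX => by
    apply e.injective
    rw [hep]
    exact Submodule.starProjection_eq_self_iff.2 ((hK X).2 hX)
  have hcomm : ∀ A ∈ M, ∀ X, p (A * X) = A * p X := by
    intro A hA X
    apply e.injective
    rw [hep]
    refine Submodule.eq_starProjection_of_mem_orthogonal (K := K) ?_ ?_
    · rw [hK]; exact hM.mul_mem _ hA _ (hpM X)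
    · rw [Submodule.mem_orthogonal]
      rintro _ ⟨Y, hY, rfl⟩
      have h1 : inner ℂ (e (Aᴴ * Y)) (e X - e (p X)) = 0 := by
        rw [hep]
        exact (Submodule.mem_orthogonal _ _).1 (Submodule.sub_starProjection_mem_orthogonal _) _
          ((hK _).2 (hM.mul_mem _ (hM.star_mem _ hA) _ hY))
      rw [← map_sub, hin] at h1
      change inner ℂ (e Y) _ = 0
      rw [← map_sub, hin, ← mul_sub]
      simpa [conjTranspose_mul, mul_assoc] using h1
  have hTc := (lin_comm_iff p T).2 (fun j k => by
    refine (hT _ ?_).symm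
    intro A hA
    exact (lin_comm_iff p A).1 (hcomm A hA) j k) 1
  rw [mul_one, hfix 1 hM.one_mem, mul_one] at hTc
  rw [← hTc]
  exact hpM T

/-- Spectral data. -/
lemma spec {Y : Matrix ι ι ℂ} (hY : Yᴴ = Y) : ∃ (Q : Matrix ι ι ℂ) (l : ι → ℂ),
    Qᴴ * Q = 1 ∧ Q * Qᴴ = 1 ∧ Y = Q * diagonal l * Qᴴ := by
  have hA : Y.IsHermitian := hY
  refine ⟨hA.eigenvectorUnitary, RCLike.ofReal ∘ hA.eigenvalues, ?_, ?_, ?_⟩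
  · exact Unitary.coe_star_mul_self hA.eigenvectorUnitary
  · exact Unitary.coe_mul_star_self hA.eigenvectorUnitary
  · have := hA.spectral_theorem
    rw [Unitary.conjStarAlgAut_apply] at this
    exact this

lemma proj_isometry {p : Matrix ι ι ℂ} (hp : pᴴ = p) (hpp : p * p = p) :
    ∃ (d : ℕ) (V : Matrix ι (Fin d) ℂ), Vᴴ * V = 1 ∧ V * Vᴴ = p := by
  obtain ⟨Q, l, h1, h2, h3⟩ := spec hp
  have hl : diagonal l = Qᴴ * p * Q := by
    rw [h3]
    simp only [mul_assoc, h1, mul_one]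
    rw [← mul_assoc, h1, one_mul]
  have hl2 : diagonal l * diagonal l = diagonal l := by
    rw [hl]
    calc Qᴴ * p * Q * (Qᴴ * p * Q) = Qᴴ * p * (Q * Qᴴ) * p * Q := by simp only [mul_assoc]
      _ = Qᴴ * (p * p) * Q := by rw [h2]; simp only [mul_assoc, mul_one]
      _ = _ := by rw [hpp]
  rw [diagonal_mul_diagonal] at hl2
  have hl3 : ∀ i, l i = 0 ∨ l i = 1 := by
    intro i
    have := congrFun (diagonal_injective hl2) i
    have h4 : l i * (l i - 1) = 0 := by linear_combination this
    rcases mul_eq_zero.1 h4 with h | h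
    · exact Or.inl h
    · exact Or.inr (by linear_combination h)
  classical
  let S := {i // l i ≠ 0}
  let e : Fin (Fintype.card S) ≃ S := (Fintype.equivFin S).symm
  refine ⟨Fintype.card S, Q.submatrix id (fun x => (e x : ι)), ?_, ?_⟩
  · rw [conjTranspose_submatrix, ← submatrix_mul _ _ _ _ _ Function.bijective_id, h1]
    apply submatrix_one
    exact Subtype.val_injective.comp e.injective
  · rw [h3]
    ext i j
    rw [Matrix.mul_apply, Matrix.mul_apply]
    simp only [mul_diagonal, submatrix_apply, conjTranspose_apply, id]
    rw [Equiv.sum_comp e (fun s : S => Q i s * star (Q j s))]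
    rw [← Finset.sum_subtype (Finset.univ.filter (fun i => l i ≠ 0)) (by simp) (fun s => Q i s * star (Q j s)), Finset.sum_filter]
    refine Finset.sum_congr rfl fun x _ => ?_
    rcases hl3 x with h | h <;> simp [h]

/-- Splitting via a hermitian element of the commutant. -/
lemma split {M : Set (Matrix ι ι ℂ)} {Y p : Matrix ι ι ℂ}
    (hY : Yᴴ = Y) (hYM : Y ∈ commutant M) (hpY : p * Y = Y) (hYp : Y * p = Y)
    (hn : ∀ c : ℂ, Y ≠ c • p) :
    ∃ q ∈ commutant M, qᴴ = q ∧ q * q = q ∧ p * q = q ∧ q * p = q ∧ q ≠ 0 ∧ q ≠ p := by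
  obtain ⟨Q, l, h1, h2, h3⟩ := spec hY
  have hex : ∃ i, l i ≠ 0 := by
    by_contra! h
    apply hn 0
    have : l = 0 := funext h
    rw [h3, this]; simp
  obtain ⟨i0, hi0⟩ := hex
  let χ : ι → ℂ := fun i => if l i = l i0 then 1 else 0
  have hχl : diagonal χ * diagonal l = l i0 • diagonal χ := by
    rw [diagonal_mul_diagonal, ← diagonal_smul]
    congr 1; ext i; by_cases h : l i = l i0 <;> simp [χ, h]
  have hlχ : diagonal l * diagonal χ = l i0 • diagonal χ := by
    rw [← hχl, diagonal_mul_diagonal, diagonal_mul_diagonal]; simp only [mul_comm]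
  have hχχ : diagonal χ * diagonal χ = diagonal χ := by
    rw [diagonal_mul_diagonal]; congr 1; ext i; simp [χ]
  have mid : ∀ D E : Matrix ι ι ℂ, Q * D * Qᴴ * (Q * E * Qᴴ) = Q * (D * E) * Qᴴ := by
    intro D E
    calc _ = Q * D * (Qᴴ * Q) * E * Qᴴ := by simp only [mul_assoc]
      _ = _ := by rw [h1]; simp only [mul_assoc, mul_one]
  have hqY : (Q * diagonal χ * Qᴴ) * Y = l i0 • (Q * diagonal χ * Qᴴ) := by
    conv_lhs => rw [h3]
    rw [mid, hχl]; simp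
  have hYq : Y * (Q * diagonal χ * Qᴴ) = l i0 • (Q * diagonal χ * Qᴴ) := by
    conv_lhs => rw [h3]
    rw [mid, hlχ]; simp
  have hq1 : (Q * diagonal χ * Qᴴ) = (l i0)⁻¹ • ((Q * diagonal χ * Qᴴ) * Y) := by
    rw [hqY, smul_smul, inv_mul_cancel₀ hi0, one_smul]
  have hq2 : (Q * diagonal χ * Qᴴ) = (l i0)⁻¹ • (Y * (Q * diagonal χ * Qᴴ)) := by
    rw [hYq, smul_smul, inv_mul_cancel₀ hi0, one_smul]
  refine ⟨Q * diagonal χ * Qᴴ, ?_, ?_, ?_, ?_, ?_, ?_, ?_⟩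
  · intro A hA
    have hc := hYM A hA
    have hB : (Qᴴ * A * Q) * diagonal l = diagonal l * (Qᴴ * A * Q) := by
      have : diagonal l = Qᴴ * Y * Q := by
        rw [h3]
        simp only [mul_assoc, h1, mul_one]
        rw [← mul_assoc, h1, one_mul]
      rw [this]
      calc Qᴴ * A * Q * (Qᴴ * Y * Q) = Qᴴ * A * (Q * Qᴴ) * Y * Q := by simp only [mul_assoc]
        _ = Qᴴ * (A * Y) * Q := by rw [h2]; simp only [mul_assoc, mul_one]
        _ = Qᴴ * Y * (Q * Qᴴ) * A * Q := by rw [h2, hc]; simp only [mul_assoc, mul_one]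
        _ = _ := by simp only [mul_assoc]
    have hB2 : (Qᴴ * A * Q) * diagonal χ = diagonal χ * (Qᴴ * A * Q) := by
      ext i j
      have := congrFun (congrFun hB i) j
      rw [mul_diagonal, diagonal_mul] at this ⊢
      by_cases h : l i = l j
      · simp [χ, h, mul_comm]
      · have : (Qᴴ * A * Q) i j * (l i - l j) = 0 := by linear_combination -this
        have : (Qᴴ * A * Q) i j = 0 := by
          rcases mul_eq_zero.1 this with h' | h'
          · exact h'
          · exact absurd (sub_eq_zero.1 h') h
        rw [this]; simp
    calc A * (Q * diagonal χ * Qᴴ) = (Q * Qᴴ) * A * (Q * diagonal χ * Qᴴ) := by rw [h2, one_mul]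
      _ = Q * ((Qᴴ * A * Q) * diagonal χ) * Qᴴ := by simp only [mul_assoc]
      _ = Q * diagonal χ * Qᴴ * A * (Q * Qᴴ) := by rw [hB2]; simp only [mul_assoc]
      _ = _ := by rw [h2, mul_one]
  · simp only [conjTranspose_mul, conjTranspose_conjTranspose, diagonal_conjTranspose, mul_assoc]
    congr 3; ext i; by_cases h : l i = l i0 <;> simp [χ, h]
  · rw [mid, hχχ]
  · rw [hq2, Matrix.mul_smul, ← mul_assoc, hpY]
  · rw [hq1, Matrix.smul_mul, mul_assoc, hYp]
  · intro h
    have : diagonal χ = 0 := by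
      calc diagonal χ = (Qᴴ * Q) * diagonal χ * (Qᴴ * Q) := by rw [h1]; simp
        _ = Qᴴ * (Q * diagonal χ * Qᴴ) * Q := by simp only [mul_assoc]
        _ = 0 := by rw [h]; simp
    have := congrFun (congrFun this i0) i0
    simp [χ] at this
  · intro h
    rw [h, hYp] at hYq
    exact hn _ hYq

/-- An orthogonal family of nonzero projections of the commutant summing to one. -/
structure Good (M : Set (Matrix ι ι ℂ)) (k : ℕ) (p : Fin k → Matrix ι ι ℂ) : Prop where
  mem : ∀ s, p s ∈ commutant M
  herm : ∀ s, (p s)ᴴ = p s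
  idem : ∀ s, p s * p s = p s
  ne : ∀ s, p s ≠ 0
  orth : ∀ s t, s ≠ t → p s * p t = 0
  sum : ∑ s, p s = 1

lemma Good.bound {M : Set (Matrix ι ι ℂ)} {k : ℕ} {p : Fin k → Matrix ι ι ℂ} (h : Good M k p) :
    k ≤ Module.finrank ℂ (Matrix ι ι ℂ) := by
  have : LinearIndependent ℂ p := by
    rw [Fintype.linearIndependent_iff]
    intro g hg s
    have h1 : p s * ∑ i, g i • p i = g s • p s := by
      rw [Finset.mul_sum, Finset.sum_eq_single s]
      · rw [Matrix.mul_smul, h.idem]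
      · intro t _ ht
        rw [Matrix.mul_smul, h.orth s t ht.symm, smul_zero]
      · simp
    rw [hg, mul_zero] at h1
    exact (smul_eq_zero.1 h1.symm).resolve_right (h.ne s)
  simpa using this.fintype_card_le_finrank

lemma Good.split {M : Set (Matrix ι ι ℂ)} {k : ℕ} {p : Fin k → Matrix ι ι ℂ} (h : Good M k p)
    (s : Fin k) {q : Matrix ι ι ℂ} (hq : q ∈ commutant M) (hqh : qᴴ = q) (hqq : q * q = q)
    (h1 : p s * q = q) (h2 : q * p s = q) (hq0 : q ≠ 0) (hqp : q ≠ p s) :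
    Good M (k + 1) (Fin.cons q (Function.update p s (p s - q))) := by
  have o1 : ∀ t, t ≠ s → q * p t = 0 := fun t ht => by
    rw [← h2, mul_assoc, h.orth s t ht.symm, mul_zero]
  have o2 : ∀ t, t ≠ s → p t * q = 0 := fun t ht => by
    rw [← h1, ← mul_assoc, h.orth t s ht, zero_mul]
  constructor
  · refine Fin.cases (by simpa using hq) fun t => ?_
    by_cases ht : t = s
    · subst ht; simpa using comm_sub (h.mem t) hq
    · simpa [ht] using h.mem t
  · refine Fin.cases (by simpa using hqh) fun t => ?_
    by_cases ht : t = s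
    · subst ht; simp [h.herm, hqh]
    · simpa [ht] using h.herm t
  · refine Fin.cases (by simpa using hqq) fun t => ?_
    by_cases ht : t = s
    · subst ht; simp [mul_sub, sub_mul, h.idem, hqq, h1, h2]
    · simpa [ht] using h.idem t
  · refine Fin.cases (by simpa using hq0) fun t => ?_
    by_cases ht : t = s
    · subst ht; simpa [sub_eq_zero] using hqp.symm
    · simpa [ht] using h.ne t
  · refine Fin.cases (Fin.cases (by simp) fun t => ?_) (fun t => Fin.cases ?_ fun t' => ?_)
    · intro _
      by_cases ht : t = s
      · subst ht; simp [mul_sub, h2, hqq]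
      · simpa [ht] using o1 t ht
    · intro _
      by_cases ht : t = s
      · subst ht; simp [sub_mul, h1, hqq]
      · simpa [ht] using o2 t ht
    · intro htt
      have htt : t ≠ t' := fun h => htt (by rw [h])
      by_cases ht : t = s
      · subst ht
        simp [htt.symm, sub_mul, o1 t' htt.symm, h.orth t t' htt]
      · by_cases ht' : t' = s
        · subst ht'
          simp [ht, mul_sub, o2 t ht, h.orth t t' htt]
        · simpa [ht, ht'] using h.orth t t' htt
  · rw [Fin.sum_univ_succ]
    simp only [Fin.cons_zero, Fin.cons_succ]
    rw [Finset.sum_update_of_mem (Finset.mem_univ s), ← h.sum,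
      ← Finset.sum_sdiff (Finset.subset_univ {s}), Finset.sum_singleton]
    abel

lemma exists_good {M : Set (Matrix ι ι ℂ)} (hM : IsVNAlgebra M) :
    ∃ (k : ℕ) (p : Fin k → Matrix ι ι ℂ), Good M k p ∧
      ∀ s, ∀ X ∈ commutant M, ∃ c : ℂ, p s * X * p s = c • p s := by
  let S : Set ℕ := {k | ∃ p, Good M k p}
  have hS : BddAbove S := ⟨Module.finrank ℂ (Matrix ι ι ℂ), by
    rintro k ⟨p, hp⟩; exact hp.bound⟩
  have hne : S.Nonempty := by
    by_cases h : (1 : Matrix ι ι ℂ) = 0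
    · exact ⟨0, Fin.elim0, ⟨fun s => s.elim0, fun s => s.elim0, fun s => s.elim0,
        fun s => s.elim0, fun s => s.elim0, by simpa using h.symm⟩⟩
    · exact ⟨1, fun _ => 1, ⟨fun _ => comm_one, by simp, by simp, fun _ => h,
        fun s t hst => absurd (Subsingleton.elim s t) hst, by simp⟩⟩
  obtain ⟨p, hp⟩ := Nat.sSup_mem hne hS
  refine ⟨_, p, hp, ?_⟩
  intro s
  have herm : ∀ Y ∈ commutant M, Yᴴ = Y → p s * Y = Y → Y * p s = Y → ∃ c : ℂ, Y = c • p s := by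
    intro Y hY hYh h1 h2
    by_contra! hcon
    obtain ⟨q, hq, hqh, hqq, a1, a2, a3, a4⟩ := Wed.split hYh hY h1 h2 hcon
    have : sSup S + 1 ∈ S := ⟨_, hp.split s hq hqh hqq a1 a2 a3 a4⟩
    have := le_csSup hS this
    omega
  intro X hX
  obtain ⟨Z, hZ⟩ : ∃ Z, Z = p s * X * p s := ⟨_, rfl⟩
  rw [← hZ]
  have hZM : Z ∈ commutant M := hZ ▸ comm_mul (comm_mul (hp.mem s) hX) (hp.mem s)
  have hZ1 : p s * Z = Z := by rw [hZ, ← mul_assoc, ← mul_assoc, hp.idem]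
  have hZ2 : Z * p s = Z := by rw [hZ, mul_assoc, hp.idem]
  have hZ3 : p s * Zᴴ = Zᴴ := by
    conv_rhs => rw [← hZ2, conjTranspose_mul, hp.herm]
  have hZ4 : Zᴴ * p s = Zᴴ := by
    conv_rhs => rw [← hZ1, conjTranspose_mul, hp.herm]
  have hZM' := comm_star hM hZM
  obtain ⟨c, hc⟩ := herm (Z + Zᴴ) (comm_add hZM hZM') (by simp [add_comm])
    (by rw [mul_add, hZ1, hZ3]) (by rw [add_mul, hZ2, hZ4])
  obtain ⟨c', hc'⟩ := herm (Complex.I • (Z - Zᴴ)) (comm_smul _ (comm_sub hZM hZM'))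
    (by
      rw [conjTranspose_smul, conjTranspose_sub, conjTranspose_conjTranspose]
      simp [← smul_neg])
    (by rw [Matrix.mul_smul, mul_sub, hZ1, hZ3]) (by rw [Matrix.smul_mul, sub_mul, hZ2, hZ4])
  refine ⟨(c - Complex.I * c') / 2, ?_⟩
  have e1 : Z = (1 / 2 : ℂ) • ((Z + Zᴴ) - Complex.I • (Complex.I • (Z - Zᴴ))) := by
    rw [smul_smul, Complex.I_mul_I]
    ext i j
    simp only [Matrix.smul_apply, Matrix.sub_apply, Matrix.add_apply, smul_eq_mul]
    ring
  rw [e1, hc, hc', smul_smul, ← sub_smul, smul_smul]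
  congr 1; ring

/-- Equivalence of projections in the commutant. -/
def Eqv (M : Set (Matrix ι ι ℂ)) (p q : Matrix ι ι ℂ) : Prop :=
  ∃ u ∈ commutant M, u * uᴴ = p ∧ uᴴ * u = q ∧ p * u = u ∧ u * q = u

lemma trace_pos_aux {n : Type*} [Fintype n] (X : Matrix n n ℂ) (c : ℂ) {p : Matrix n n ℂ}
    (hp : pᴴ = p) (hpp : p * p = p) (hX : Xᴴ * X = c • p) (hp0 : p ≠ 0) :
    ∃ r : ℝ, 0 ≤ r ∧ c = r := by
  obtain ⟨i, j, hij⟩ : ∃ i j, p i j ≠ 0 := by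
    by_contra! h
    exact hp0 (by ext i j; exact h i j)
  have gen : ∀ Y : Matrix n n ℂ, (Yᴴ * Y) j j = ((∑ l, ‖Y l j‖ ^ 2 : ℝ) : ℂ) := by
    intro Y
    rw [Matrix.mul_apply]
    push_cast
    refine Finset.sum_congr rfl fun l _ => ?_
    rw [conjTranspose_apply]
    exact Complex.conj_mul' _
  have h1 := gen X
  have h2 := gen p
  rw [hp, hpp] at h2
  rw [hX, Matrix.smul_apply, smul_eq_mul, h2] at h1
  have hpos : 0 < ∑ l, ‖p l j‖ ^ 2 :=
    Finset.sum_pos' (fun _ _ => by positivity) ⟨i, Finset.mem_univ _, by positivity⟩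
  refine ⟨(∑ l, ‖X l j‖ ^ 2) / (∑ l, ‖p l j‖ ^ 2), by positivity, ?_⟩
  push_cast at h1 ⊢
  rw [← h1, mul_div_assoc, div_self, mul_one]
  exact_mod_cast hpos.ne'

open ComplexOrder in
lemma schur {M : Set (Matrix ι ι ℂ)} (hM : IsVNAlgebra M) {k : ℕ} {p : Fin k → Matrix ι ι ℂ}
    (h : Good M k p) (hirr : ∀ s, ∀ X ∈ commutant M, ∃ c : ℂ, p s * X * p s = c • p s)
    (s t : Fin k) {X : Matrix ι ι ℂ} (hX : X ∈ commutant M) (h1 : p s * X = X) (h2 : X * p t = X)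
    (h0 : X ≠ 0) : Eqv M (p s) (p t) := by
  have h1' : Xᴴ * p s = Xᴴ := by
    conv_rhs => rw [← h1, conjTranspose_mul, h.herm]
  have h2' : p t * Xᴴ = Xᴴ := by
    conv_rhs => rw [← h2, conjTranspose_mul, h.herm]
  have hX' := comm_star hM hX
  obtain ⟨c, hc⟩ := hirr t _ (comm_mul hX' hX)
  obtain ⟨d, hd⟩ := hirr s _ (comm_mul hX hX')
  rw [← mul_assoc, h2', mul_assoc, h2] at hc
  rw [← mul_assoc, h1, mul_assoc, h1'] at hd
  have hcd : c = d := by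
    have e1 : X * (Xᴴ * X) = c • X := by rw [hc, Matrix.mul_smul, h2]
    have e2 : X * (Xᴴ * X) = d • X := by rw [← mul_assoc, hd, Matrix.smul_mul, h1]
    exact smul_left_injective ℂ h0 (e1.symm.trans e2)
  subst hcd
  obtain ⟨r, hr, rfl⟩ := trace_pos_aux X c (h.herm t) (h.idem t) hc (h.ne t)
  have hr0 : r ≠ 0 := by
    rintro rfl
    apply h0
    rw [Complex.ofReal_zero, zero_smul] at hc
    exact conjTranspose_mul_self_eq_zero.1 hc
  have hsq : ((Real.sqrt r : ℝ) : ℂ)⁻¹ * ((Real.sqrt r : ℝ) : ℂ)⁻¹ * (r : ℂ) = 1 := by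
    have : (Real.sqrt r)⁻¹ * (Real.sqrt r)⁻¹ * r = 1 := by
      rw [← mul_inv, Real.mul_self_sqrt hr, inv_mul_cancel₀ hr0]
    exact_mod_cast this
  have hst : ((((Real.sqrt r : ℝ) : ℂ)⁻¹) • X)ᴴ = (((Real.sqrt r : ℝ) : ℂ)⁻¹) • Xᴴ := by
    rw [conjTranspose_smul]; simp
  refine ⟨(((Real.sqrt r : ℝ) : ℂ)⁻¹) • X, comm_smul _ hX, ?_, ?_, ?_, ?_⟩
  · rw [hst, smul_mul_smul_comm, hd, smul_smul, hsq, one_smul]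
  · rw [hst, smul_mul_smul_comm, hc, smul_smul, hsq, one_smul]
  · rw [Matrix.mul_smul, h1]
  · rw [Matrix.smul_mul, h2]

lemma Eqv.symm {M : Set (Matrix ι ι ℂ)} (hM : IsVNAlgebra M) {p q : Matrix ι ι ℂ}
    (hp : pᴴ = p) (hq : qᴴ = q) (h : Eqv M p q) : Eqv M q p := by
  obtain ⟨u, hu, h1, h2, h3, h4⟩ := h
  refine ⟨uᴴ, comm_star hM hu, by simpa using h2, by simpa using h1, ?_, ?_⟩
  · conv_rhs => rw [← h4, conjTranspose_mul, hq]
  · conv_rhs => rw [← h3, conjTranspose_mul, hp]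

lemma Eqv.trans {M : Set (Matrix ι ι ℂ)} {p q r : Matrix ι ι ℂ}
    (h : Eqv M p q) (h' : Eqv M q r) : Eqv M p r := by
  obtain ⟨u, hu, h1, h2, h3, h4⟩ := h
  obtain ⟨v, hv, g1, g2, g3, g4⟩ := h'
  refine ⟨u * v, comm_mul hu hv, ?_, ?_, ?_, ?_⟩
  · rw [conjTranspose_mul, mul_assoc, ← mul_assoc v, g1, ← mul_assoc, h4, h1]
  · rw [conjTranspose_mul, mul_assoc, ← mul_assoc uᴴ, h2, g3, g2]
  · rw [← mul_assoc, h3]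
  · rw [mul_assoc, g4]

/-- Enumerating the classes of an equivalence relation. -/
lemma classes {k : ℕ} (r : Setoid (Fin k)) :
    ∃ (m : ℕ) (d : Fin m → ℕ) (σ : (Σ a, Fin (d a)) ≃ Fin k) (ρ : Fin m → Fin k),
      (∀ a j, r (σ ⟨a, j⟩) (ρ a)) ∧ ∀ a b, r (ρ a) (ρ b) → a = b := by
  classical
  let eQ : Fin (Fintype.card (Quotient r)) ≃ Quotient r := (Fintype.equivFin _).symm
  let F : Fin (Fintype.card (Quotient r)) → Type := fun a => {s : Fin k // Quotient.mk r s = eQ a}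
  let σ : (Σ a, Fin (Fintype.card (F a))) ≃ Fin k :=
    ((Equiv.sigmaCongrRight fun a => (Fintype.equivFin (F a)).symm).trans
      (Equiv.sigmaCongrLeft (β := fun c => {s : Fin k // Quotient.mk r s = c}) eQ)).trans
      (Equiv.sigmaFiberEquiv (Quotient.mk r))
  refine ⟨_, _, σ, fun a => (eQ a).out, ?_, ?_⟩
  · intro a j
    apply Quotient.exact
    rw [Quotient.out_eq]
    exact ((Fintype.equivFin (F a)).symm j).2
  · intro a b h
    have := Quotient.sound h
    rw [Quotient.out_eq, Quotient.out_eq] at this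
    exact eQ.injective this

/-- The core structural statement: an adapted family of isometries. -/
lemma core {M : Set (Matrix ι ι ℂ)} (hM : IsVNAlgebra M) :
    ∃ (m : ℕ) (d₁ d₂ : Fin m → ℕ) (W : ∀ a, Fin (d₂ a) → Matrix ι (Fin (d₁ a)) ℂ),
      (∀ a j, (W a j)ᴴ * W a j = 1) ∧
      (∀ a j b l, (⟨a, j⟩ : Σ a, Fin (d₂ a)) ≠ ⟨b, l⟩ → (W a j)ᴴ * W b l = 0) ∧
      (∑ a, ∑ j, W a j * (W a j)ᴴ = 1) ∧
      (∀ A ∈ M, ∃ f : ∀ a, Matrix (Fin (d₁ a)) (Fin (d₁ a)) ℂ,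
        ∀ a j, A * W a j = W a j * f a) ∧
      (∀ B ∈ commutant M, (∀ a b j l, a ≠ b → (W a j)ᴴ * B * W b l = 0) ∧
        ∀ a j l, ∃ c : ℂ, (W a j)ᴴ * B * W a l = c • 1) := by
  obtain ⟨k, p, hp, hirr⟩ := exists_good hM
  let r : Setoid (Fin k) :=
    { r := fun s t => Eqv M (p s) (p t)
      iseqv := ⟨fun s => ⟨p s, hp.mem s, by rw [hp.herm, hp.idem], by rw [hp.herm, hp.idem],
          hp.idem s, hp.idem s⟩,
        fun {s t} h => h.symm hM (hp.herm s) (hp.herm t), fun h h' => h.trans h'⟩ }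
  obtain ⟨m, d₂, σ, ρ, hσ, hρ⟩ := classes r
  have hσ' : ∀ a j, Eqv M (p (σ ⟨a, j⟩)) (p (ρ a)) := hσ
  choose v hvM hv1 hv2 hv3 hv4 using hσ'
  choose d V hV1 hV2 using fun s => proj_isometry (hp.herm s) (hp.idem s)
  have hpV : ∀ s, p s * V s = V s := fun s => by rw [← hV2, Matrix.mul_assoc, hV1, Matrix.mul_one]
  have hv3' : ∀ a j, (v a j)ᴴ * p (σ ⟨a, j⟩) = (v a j)ᴴ := fun a j => by
    conv_rhs => rw [← hv3 a j, conjTranspose_mul, hp.herm]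
  have hv4' : ∀ a j, p (ρ a) * (v a j)ᴴ = (v a j)ᴴ := fun a j => by
    conv_rhs => rw [← hv4 a j, conjTranspose_mul, hp.herm]
  refine ⟨m, fun a => d (ρ a), d₂, fun a j => v a j * V (ρ a), ?_, ?_, ?_, ?_, ?_⟩
  · intro a j
    rw [conjTranspose_mul, Matrix.mul_assoc, ← Matrix.mul_assoc (v a j)ᴴ, hv2, hpV, hV1]
  · intro a j b l hne
    have : (v a j)ᴴ * v b l = 0 := by
      rw [← hv3', ← hv3 b l, Matrix.mul_assoc, ← Matrix.mul_assoc (p _) (p _),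
        hp.orth _ _ (σ.injective.ne hne)]
      simp
    rw [conjTranspose_mul, Matrix.mul_assoc, ← Matrix.mul_assoc (v a j)ᴴ, this]
    simp
  · have : ∀ a j, v a j * V (ρ a) * (v a j * V (ρ a))ᴴ = p (σ ⟨a, j⟩) := by
      intro a j
      rw [conjTranspose_mul, Matrix.mul_assoc, ← Matrix.mul_assoc (V _), hV2, hv4', hv1]
    simp only [this]
    rw [← hp.sum, ← Equiv.sum_comp σ, Fintype.sum_sigma]
  · intro A hA
    refine ⟨fun a => (V (ρ a))ᴴ * A * V (ρ a), fun a j => ?_⟩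
    calc A * (v a j * V (ρ a)) = (v a j * p (ρ a)) * A * V (ρ a) := by
          rw [← Matrix.mul_assoc, hvM a j A hA, hv4]
      _ = _ := by rw [← hV2]; simp only [Matrix.mul_assoc]
  · intro B hB
    have hX : ∀ a b j l, (v a j * V (ρ a))ᴴ * B * (v b l * V (ρ b)) =
        (V (ρ a))ᴴ * ((v a j)ᴴ * B * v b l) * V (ρ b) := by
      intro a b j l
      rw [conjTranspose_mul]; simp only [Matrix.mul_assoc]
    have hXM : ∀ a b j l, (v a j)ᴴ * B * v b l ∈ commutant M := fun a b j l =>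
      comm_mul (comm_mul (comm_star hM (hvM a j)) hB) (hvM b l)
    have hX1 : ∀ a b j l, p (ρ a) * ((v a j)ᴴ * B * v b l) = (v a j)ᴴ * B * v b l := by
      intro a b j l
      rw [← Matrix.mul_assoc, ← Matrix.mul_assoc, hv4']
    have hX2 : ∀ a b j l, ((v a j)ᴴ * B * v b l) * p (ρ b) = (v a j)ᴴ * B * v b l := by
      intro a b j l
      rw [Matrix.mul_assoc, hv4]
    constructor
    · intro a b j l hab
      rw [hX]
      by_cases h0 : (v a j)ᴴ * B * v b l = 0
      · rw [h0]; simp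
      · exact absurd (hρ a b (schur hM hp hirr _ _ (hXM a b j l) (hX1 a b j l) (hX2 a b j l) h0)) hab
    · intro a j l
      obtain ⟨c, hc⟩ := hirr (ρ a) _ (hXM a a j l)
      rw [hX1, hX2] at hc
      refine ⟨c, ?_⟩
      rw [hX, hc, Matrix.mul_smul, Matrix.smul_mul, Matrix.mul_assoc, hpV, hV1]

end Wed

/-- Wedderburn decomposition / classification of finite-dimensional
von Neumann algebras.  For a von Neumann algebra `M` on a finite-dimensional complex
Hilbert space `H` (with orthonormal basis indexed by `ι`), there is a finite index set
(wlog `Fin m`), dimensions `d₁ a`, `d₂ a` of the factors `H_{A_α}`, `H_{Ā_α}`, and a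
unitary identification `U : H ≅ ⊕_α (H_{A_α} ⊗ H_{Ā_α})` under which:
`M = ⊕_α (L(H_{A_α}) ⊗ I)`, `M' = ⊕_α (I ⊗ L(H_{Ā_α}))`, and the center
`Z_M = M ∩ M'` consists of the block-scalar operators `⊕_α c_α I`. -/
theorem wedderburn_decomposition {ι : Type*} [Fintype ι] [DecidableEq ι]
    (M : Set (Matrix ι ι ℂ)) (hM : IsVNAlgebra M) :
    ∃ (m : ℕ) (d₁ d₂ : Fin m → ℕ)
      (U : Matrix ι (Σ a : Fin m, Fin (d₁ a) × Fin (d₂ a)) ℂ),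
      Uᴴ * U = 1 ∧ U * Uᴴ = 1 ∧
      M = (fun B => U * B * Uᴴ) ''
        {B | ∃ f : (a : Fin m) → Matrix (Fin (d₁ a)) (Fin (d₁ a)) ℂ,
          B = Matrix.blockDiagonal'
            (fun a => (f a) ⊗ₖ (1 : Matrix (Fin (d₂ a)) (Fin (d₂ a)) ℂ))} ∧
      commutant M = (fun B => U * B * Uᴴ) ''
        {B | ∃ g : (a : Fin m) → Matrix (Fin (d₂ a)) (Fin (d₂ a)) ℂ,
          B = Matrix.blockDiagonal'
            (fun a => (1 : Matrix (Fin (d₁ a)) (Fin (d₁ a)) ℂ) ⊗ₖ (g a))} ∧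
      M ∩ commutant M = (fun B => U * B * Uᴴ) ''
        {B | ∃ c : Fin m → ℂ,
          B = Matrix.blockDiagonal'
            (fun a => c a •
              (1 : Matrix (Fin (d₁ a) × Fin (d₂ a)) (Fin (d₁ a) × Fin (d₂ a)) ℂ))} := by
  obtain ⟨m, d₁, d₂, W, hW1, hW2, hW3, hA, hB⟩ := Wed.core hM
  let U : Matrix ι (Σ a : Fin m, Fin (d₁ a) × Fin (d₂ a)) ℂ :=
    Matrix.of fun i z => W z.1 z.2.2 i z.2.1
  have hUentry : ∀ (B : Matrix ι ι ℂ) a x j b y l,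
      (Uᴴ * B * U) ⟨a, (x, j)⟩ ⟨b, (y, l)⟩ = ((W a j)ᴴ * B * W b l) x y := by
    intro B a x j b y l
    rfl
  have hU1 : Uᴴ * U = 1 := by
    ext ⟨a, x, j⟩ ⟨b, y, l⟩
    have h1 := hUentry 1 a x j b y l
    rw [Matrix.mul_one, Matrix.mul_one] at h1
    rw [h1]
    by_cases h : (⟨a, j⟩ : Σ a, Fin (d₂ a)) = ⟨b, l⟩
    · obtain ⟨rfl, h⟩ := Sigma.mk.inj_iff.1 h
      obtain rfl := eq_of_heq h
      rw [hW1]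
      simp [Matrix.one_apply]
    · rw [hW2 a j b l h, Matrix.one_apply_ne]
      · rfl
      · rintro h'
        apply h
        obtain ⟨rfl, h'⟩ := Sigma.mk.inj_iff.1 h'
        have := eq_of_heq h'
        simp only [Prod.mk.injEq] at this
        rw [this.2]
  have hU2 : U * Uᴴ = 1 := by
    rw [← hW3]
    ext i i'
    simp only [Matrix.mul_apply, Matrix.sum_apply, Fintype.sum_sigma, Fintype.sum_prod_type]
    refine Finset.sum_congr rfl fun a _ => ?_
    rw [Finset.sum_comm]
    rfl
  have hback : ∀ X : Matrix ι ι ℂ, U * (Uᴴ * X * U) * Uᴴ = X := by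
    intro X
    calc _ = (U * Uᴴ) * X * (U * Uᴴ) := by simp only [Matrix.mul_assoc]
      _ = X := by rw [hU2]; simp
  have hforth : ∀ X : Matrix (Σ a : Fin m, Fin (d₁ a) × Fin (d₂ a))
      (Σ a : Fin m, Fin (d₁ a) × Fin (d₂ a)) ℂ, Uᴴ * (U * X * Uᴴ) * U = X := by
    intro X
    calc _ = (Uᴴ * U) * X * (Uᴴ * U) := by simp only [Matrix.mul_assoc]
      _ = X := by rw [hU1]; simp
  have hmul : ∀ X Y : Matrix (Σ a : Fin m, Fin (d₁ a) × Fin (d₂ a))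
      (Σ a : Fin m, Fin (d₁ a) × Fin (d₂ a)) ℂ, U * X * Uᴴ * (U * Y * Uᴴ) = U * (X * Y) * Uᴴ := by
    intro X Y
    calc _ = U * X * (Uᴴ * U) * Y * Uᴴ := by simp only [Matrix.mul_assoc]
      _ = _ := by rw [hU1]; simp only [Matrix.mul_assoc, Matrix.one_mul]
  have hM1 : ∀ A ∈ M, ∃ f : (a : Fin m) → Matrix (Fin (d₁ a)) (Fin (d₁ a)) ℂ,
      Uᴴ * A * U = Matrix.blockDiagonal'
        (fun a => (f a) ⊗ₖ (1 : Matrix (Fin (d₂ a)) (Fin (d₂ a)) ℂ)) := by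
    intro A hAM
    obtain ⟨f, hf⟩ := hA A hAM
    refine ⟨f, ?_⟩
    ext ⟨a, x, j⟩ ⟨b, y, l⟩
    rw [hUentry, Matrix.mul_assoc, hf, ← Matrix.mul_assoc]
    by_cases hab : a = b
    · subst hab
      rw [Matrix.blockDiagonal'_apply_eq, Matrix.kroneckerMap_apply]
      by_cases hjl : j = l
      · subst hjl
        rw [hW1]; simp
      · rw [hW2 a j a l (by simpa using hjl)]
        simp [hjl]
    · rw [Matrix.blockDiagonal'_apply_ne _ _ _ hab,
        hW2 a j b l (fun h => hab (Sigma.mk.inj_iff.1 h).1)]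
      simp
  have hM2 : ∀ B ∈ commutant M, ∃ g : (a : Fin m) → Matrix (Fin (d₂ a)) (Fin (d₂ a)) ℂ,
      Uᴴ * B * U = Matrix.blockDiagonal'
        (fun a => (1 : Matrix (Fin (d₁ a)) (Fin (d₁ a)) ℂ) ⊗ₖ (g a)) := by
    intro B hBM
    obtain ⟨h0, h1⟩ := hB B hBM
    choose c hc using h1
    refine ⟨fun a => Matrix.of (c a), ?_⟩
    ext ⟨a, x, j⟩ ⟨b, y, l⟩
    rw [hUentry]
    by_cases hab : a = b
    · subst hab
      rw [Matrix.blockDiagonal'_apply_eq, Matrix.kroneckerMap_apply, hc]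
      simp [mul_comm]
    · rw [Matrix.blockDiagonal'_apply_ne _ _ _ hab, h0 a b j l hab]
      rfl
  have hcm : ∀ (f : (a : Fin m) → Matrix (Fin (d₁ a)) (Fin (d₁ a)) ℂ)
      (g : (a : Fin m) → Matrix (Fin (d₂ a)) (Fin (d₂ a)) ℂ),
      Matrix.blockDiagonal' (fun a => (f a) ⊗ₖ (1 : Matrix (Fin (d₂ a)) (Fin (d₂ a)) ℂ)) *
        Matrix.blockDiagonal' (fun a => (1 : Matrix (Fin (d₁ a)) (Fin (d₁ a)) ℂ) ⊗ₖ (g a)) =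
      Matrix.blockDiagonal' (fun a => (1 : Matrix (Fin (d₁ a)) (Fin (d₁ a)) ℂ) ⊗ₖ (g a)) *
        Matrix.blockDiagonal' (fun a => (f a) ⊗ₖ (1 : Matrix (Fin (d₂ a)) (Fin (d₂ a)) ℂ)) := by
    intro f g
    rw [← Matrix.blockDiagonal'_mul, ← Matrix.blockDiagonal'_mul]
    congr 1
    ext1 a
    rw [← Matrix.mul_kronecker_mul, ← Matrix.mul_kronecker_mul]
    simp
  have hD1 : ∀ f : (a : Fin m) → Matrix (Fin (d₁ a)) (Fin (d₁ a)) ℂ,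
      U * Matrix.blockDiagonal'
        (fun a => (f a) ⊗ₖ (1 : Matrix (Fin (d₂ a)) (Fin (d₂ a)) ℂ)) * Uᴴ ∈ M := by
    intro f
    apply Wed.bicomm hM
    intro B hBM
    obtain ⟨g, hg⟩ := hM2 B hBM
    rw [← hback B, hg, hmul, hmul, hcm]
  have hD2 : ∀ g : (a : Fin m) → Matrix (Fin (d₂ a)) (Fin (d₂ a)) ℂ,
      U * Matrix.blockDiagonal'
        (fun a => (1 : Matrix (Fin (d₁ a)) (Fin (d₁ a)) ℂ) ⊗ₖ (g a)) * Uᴴ ∈ commutant M := by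
    intro g A hAM
    obtain ⟨f, hf⟩ := hM1 A hAM
    rw [← hback A, hf, hmul, hmul, hcm]
  refine ⟨m, d₁, d₂, U, hU1, hU2, ?_, ?_, ?_⟩
  · ext A
    constructor
    · intro h
      exact ⟨_, hM1 A h, hback A⟩
    · rintro ⟨_, ⟨f, rfl⟩, rfl⟩
      exact hD1 f
  · ext A
    constructor
    · intro h
      exact ⟨_, hM2 A h, hback A⟩
    · rintro ⟨_, ⟨f, rfl⟩, rfl⟩
      exact hD2 f
  · ext A
    constructor
    · rintro ⟨h1, h2⟩
      obtain ⟨f, hf⟩ := hM1 A h1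
      obtain ⟨g, hg⟩ := hM2 A h2
      refine ⟨_, ?_, hback A⟩
      have hfg := Matrix.blockDiagonal'_injective (hf.symm.trans hg)
      have hsc : ∀ a, ∃ c : ℂ, (f a) ⊗ₖ (1 : Matrix (Fin (d₂ a)) (Fin (d₂ a)) ℂ) =
          c • (1 : Matrix (Fin (d₁ a) × Fin (d₂ a)) (Fin (d₁ a) × Fin (d₂ a)) ℂ) := by
        intro a
        by_cases hne : Nonempty (Fin (d₁ a) × Fin (d₂ a))
        · obtain ⟨x0, j0⟩ := hne
          refine ⟨g a j0 j0, ?_⟩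
          ext ⟨x, j⟩ ⟨y, l⟩
          have e := congrFun (congrFun (congrFun hfg a) (x, j0)) (y, j0)
          simp only [Matrix.kroneckerMap_apply, Matrix.one_apply_eq, mul_one] at e
          rw [Matrix.kroneckerMap_apply, e, Matrix.smul_apply, ← Matrix.one_kronecker_one,
            Matrix.kroneckerMap_apply, smul_eq_mul]
          ring
        · refine ⟨0, ?_⟩
          ext z
          exact absurd ⟨z⟩ hne
      choose c hc using hsc
      refine ⟨c, ?_⟩
      rw [hf]
      congr 1
      exact funext hc
    · rintro ⟨_, ⟨c, rfl⟩, rfl⟩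
      constructor
      · have := hD1 (fun a => c a • 1)
        simpa only [Matrix.smul_kronecker, Matrix.one_kronecker_one] using this
      · have := hD2 (fun a => c a • 1)
        simpa only [Matrix.kronecker_smul, Matrix.one_kronecker_one] using this
end

section
/- Let H_L and H be finite-dimensional complex Hilbert spaces, V : H_L → H an isometry, and H = H_A ⊗ H_Ā a tensor factorization. If the set M := V†(L(H_A) ⊗ I_Ā)V = {V†(O_A ⊗ I_Ā)V : O_A ∈ L(H_A)} is closed under operator multiplication, then M is a von Neumann algebra on H_L and the triple (V, A, M) satisfies complementary recovery. -/
open Matrix Kronecker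

/-- The set `V†(L(H_A) ⊗ I_Ā)V` of logical operators correctable from `A`. -/
def correctableOps {ιA ιB ιL : Type*} [Fintype ιA] [Fintype ιB] [DecidableEq ιB]
    [Fintype ιL] (V : Matrix (ιA × ιB) ιL ℂ) : Set (Matrix ιL ιL ℂ) :=
  {O | ∃ OA : Matrix ιA ιA ℂ, O = Vᴴ * (OA ⊗ₖ (1 : Matrix ιB ιB ℂ)) * V}

/-- The set `V†(I_A ⊗ L(H_Ā))V` of logical operators correctable from `Ā`. -/
def correctableOpsBar {ιA ιB ιL : Type*} [Fintype ιA] [DecidableEq ιA] [Fintype ιB]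
    [Fintype ιL] (V : Matrix (ιA × ιB) ιL ℂ) : Set (Matrix ιL ιL ℂ) :=
  {O | ∃ OB : Matrix ιB ιB ℂ, O = Vᴴ * ((1 : Matrix ιA ιA ℂ) ⊗ₖ OB) * V}

/-- The triple `(V, A, M)` satisfies complementary recovery: `M` is correctable from `A`
and its commutant `M'` is correctable from `Ā`. -/
def ComplementaryRecovery {ιA ιB ιL : Type*}
    [Fintype ιA] [DecidableEq ιA] [Fintype ιB] [DecidableEq ιB] [Fintype ιL]
    (V : Matrix (ιA × ιB) ιL ℂ) (M : Set (Matrix ιL ιL ℂ)) : Prop :=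
  M ⊆ correctableOps V ∧ commutant M ⊆ correctableOpsBar V

/-- Factor a linear map through another one with smaller kernel. -/
lemma exists_comp_of_ker_le {E F G : Type*} [AddCommGroup E] [Module ℂ E]
    [AddCommGroup F] [Module ℂ F] [AddCommGroup G] [Module ℂ G]
    (f : E →ₗ[ℂ] F) (g : E →ₗ[ℂ] G) (h : ∀ x, f x = 0 → g x = 0) :
    ∃ k : F →ₗ[ℂ] G, ∀ x, k (f x) = g x := by
  obtain ⟨s, hs⟩ := f.rangeRestrict.exists_rightInverse_of_surjective f.range_rangeRestrict
  obtain ⟨k, hk⟩ := LinearMap.exists_extend (g ∘ₗ s)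
  refine ⟨k, fun x => ?_⟩
  have h1 := LinearMap.congr_fun hk (f.rangeRestrict x)
  have h2 := congrArg Subtype.val (LinearMap.congr_fun hs (f.rangeRestrict x))
  simp at h1 h2
  rw [h1, ← sub_eq_zero, ← map_sub]
  apply h
  rw [map_sub, h2, sub_self]

open scoped ComplexOrder in
/-- Matrix version, assuming `Wᴴ W` commutes with `Z`. -/
lemma exists_mul_eq_of_gram_commute {m n : Type*} [Fintype m] [DecidableEq m] [Fintype n]
    [DecidableEq n] (W : Matrix m n ℂ) (Z : Matrix n n ℂ)
    (h : (Wᴴ * W) * Z = Z * (Wᴴ * W)) : ∃ Y : Matrix m m ℂ, Y * W = W * Z := by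
  obtain ⟨k, hk⟩ := exists_comp_of_ker_le W.mulVecLin (W * Z).mulVecLin (by
    intro x hx
    simp only [Matrix.mulVecLin_apply] at hx ⊢
    rw [← Matrix.mulVec_mulVec, ← Matrix.conjTranspose_mul_self_mulVec_eq_zero,
      Matrix.mulVec_mulVec, h, ← Matrix.mulVec_mulVec, ← Matrix.mulVec_mulVec, hx]
    simp)
  refine ⟨LinearMap.toMatrix' k, ?_⟩
  apply Matrix.toLin'.injective
  apply LinearMap.ext
  intro x
  have := hk x
  simp only [Matrix.mulVecLin_apply] at this
  rw [Matrix.toLin'_mul, LinearMap.comp_apply, Matrix.toLin'_toMatrix', Matrix.toLin'_apply,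
    Matrix.toLin'_apply, this]

lemma commutant_correctableOps_subset {ιA ιB ιL : Type*}
    [Fintype ιA] [DecidableEq ιA] [Fintype ιB] [DecidableEq ιB]
    [Fintype ιL] [DecidableEq ιL]
    (V : Matrix (ιA × ιB) ιL ℂ) (hV : Vᴴ * V = 1) :
    commutant (correctableOps V) ⊆ correctableOpsBar V := by
  intro X hX
  let C : ιA → Matrix ιB ιL ℂ := fun a => Matrix.of fun b l => V (a, b) l
  have hC : ∀ a a', (C a)ᴴ * C a' * X = X * ((C a)ᴴ * C a') := by
    intro a a'
    have := hX _ ⟨Matrix.single a a' 1, rfl⟩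
    have e : Vᴴ * (Matrix.single a a' (1:ℂ) ⊗ₖ (1 : Matrix ιB ιB ℂ)) * V = (C a)ᴴ * C a' := by
      ext i j
      simp [Matrix.mul_apply, C, Fintype.sum_prod_type, Matrix.single_apply, Matrix.one_apply,
        ite_and, Finset.sum_ite_eq, Finset.sum_ite_eq']
    rwa [e] at this
  let W : Matrix ιB (ιA × ιL) ℂ := Matrix.of fun b p => V (p.1, b) p.2
  obtain ⟨Y, hY⟩ := exists_mul_eq_of_gram_commute W ((1 : Matrix ιA ιA ℂ) ⊗ₖ X) (by
    ext ⟨a, l⟩ ⟨a', l'⟩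
    have := congrFun (congrFun (hC a a') l) l'
    rw [Matrix.mul_apply, Matrix.mul_apply] at this ⊢
    simp only [Fintype.sum_prod_type, Matrix.kroneckerMap_apply, Matrix.one_apply]
    simp only [ite_mul, mul_ite, one_mul, zero_mul, mul_zero]
    rw [Finset.sum_eq_single a' (by intro b _ hb; simp [hb]) (by simp),
      Finset.sum_eq_single a (by intro b _ hb; simp [hb.symm]) (by simp)]
    simp only [if_true]
    exact this)
  refine ⟨Y, ?_⟩
  have key : ((1 : Matrix ιA ιA ℂ) ⊗ₖ Y) * V = V * X := by
    ext ⟨a, b⟩ l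
    have := congrFun (congrFun hY b) (a, l)
    rw [Matrix.mul_apply, Matrix.mul_apply] at this ⊢
    simp only [Fintype.sum_prod_type, Matrix.kroneckerMap_apply, Matrix.one_apply, W,
      Matrix.of_apply, ite_mul, mul_ite, one_mul, zero_mul, mul_zero] at this ⊢
    rw [Finset.sum_eq_single a (by intro b _ hb; simp [hb.symm]) (by simp)]
    rw [Finset.sum_eq_single a (by intro b _ hb; simp [hb]) (by simp)] at this
    simpa [Matrix.mul_apply] using this
  rw [Matrix.mul_assoc, key, ← Matrix.mul_assoc, hV, Matrix.one_mul]

/-- if the set `M := V†(L(H_A) ⊗ I_Ā)V` is closed under operator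
multiplication, then `M` is a von Neumann algebra on `H_L` and `(V, A, M)` satisfies
complementary recovery. -/
theorem correctableOps_isVNAlgebra_and_complementaryRecovery {ιA ιB ιL : Type*}
    [Fintype ιA] [DecidableEq ιA] [Fintype ιB] [DecidableEq ιB]
    [Fintype ιL] [DecidableEq ιL]
    (V : Matrix (ιA × ιB) ιL ℂ) (hV : Vᴴ * V = 1)
    (hmul : ∀ X ∈ correctableOps V, ∀ Y ∈ correctableOps V, X * Y ∈ correctableOps V) :
    IsVNAlgebra (correctableOps V) ∧ ComplementaryRecovery V (correctableOps V) := by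
  refine ⟨⟨?_, hmul, ?_, ?_, ?_⟩, subset_rfl, commutant_correctableOps_subset V hV⟩
  · rintro _ ⟨P, rfl⟩ _ ⟨Q, rfl⟩
    exact ⟨P + Q, by rw [Matrix.add_kronecker, Matrix.mul_add, Matrix.add_mul]⟩
  · rintro c _ ⟨P, rfl⟩
    exact ⟨c • P, by rw [Matrix.smul_kronecker, Matrix.mul_smul, Matrix.smul_mul]⟩
  · rintro _ ⟨P, rfl⟩
    exact ⟨Pᴴ, by simp [Matrix.conjTranspose_mul, Matrix.conjTranspose_kronecker, Matrix.mul_assoc]⟩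
  · exact ⟨1, by rw [Matrix.one_kronecker_one, Matrix.mul_one, hV]⟩
end

section
/- Let V : (ℂ²)^⊗3 → (ℂ²)^⊗6 be the isometry defined on the computational basis (α, i, j ∈ {0,1}) by V(|α⟩⊗|i⟩⊗|j⟩) = (1/√2) ∑_{b∈{0,1}} |α⟩⊗|i⟩⊗|b⟩⊗|α⟩⊗|j⟩⊗|α·b⟩, and let A be the first three qubits of (ℂ²)^⊗6. For a density matrix ρ on (ℂ²)^⊗3 and α ∈ {0,1}, let P_α = |α⟩⟨α|⊗I⊗I, p_α = Tr(P_α ρ), and for p_α > 0 let σ_α be the reduced density matrix on the second qubit of P_α ρ P_α / p_α (i.e. the partial trace over the first and third qubits). Then for every density matrix ρ on (ℂ²)^⊗3: S(Tr_{4,5,6}(V ρ V†)) = -∑_α p_α log₂ p_α + ∑_α p_α S(σ_α) + p₁. (This is the Ryu–Takayanagi formula S_A = S_c + S_q + Tr(ρL) with area operator L = |1⟩⟨1|⊗I⊗I.) -/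
open Matrix Kronecker
open scoped ComplexOrder

/-- Partial trace over the second (right) tensor factor. -/
noncomputable def ptraceRight {ιA ιB : Type*} [Fintype ιB]
    (ρ : Matrix (ιA × ιB) (ιA × ιB) ℂ) : Matrix ιA ιA ℂ :=
  Matrix.of fun x y => ∑ j : ιB, ρ (x, j) (y, j)

/-- The von Neumann entropy (base 2) of a (Hermitian) matrix, computed from its
eigenvalues (with the convention `0 · log₂ 0 = 0`). -/
noncomputable def vnEntropy {ι : Type*} [Fintype ι] [DecidableEq ι]
    (ρ : Matrix ι ι ℂ) : ℝ :=
  letI : Decidable ρ.IsHermitian := Classical.propDecidable _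
  if h : ρ.IsHermitian then -∑ i, h.eigenvalues i * Real.logb 2 (h.eigenvalues i) else 0

/-- The six-qubit encoding isometry
`V(|α⟩⊗|i⟩⊗|j⟩) = (1/√2) ∑_b |α⟩⊗|i⟩⊗|b⟩⊗|α⟩⊗|j⟩⊗|α·b⟩`.
The boundary `(ℂ²)^⊗6` is grouped as two triples; `A` is the first triple. -/
noncomputable def V15 :
    Matrix ((Fin 2 × Fin 2 × Fin 2) × (Fin 2 × Fin 2 × Fin 2)) (Fin 2 × Fin 2 × Fin 2) ℂ :=
  Matrix.of fun q x =>
    if q.1.1 = x.1 ∧ q.1.2.1 = x.2.1 ∧ q.2.1 = x.1 ∧ q.2.2.1 = x.2.2 ∧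
        q.2.2.2 = x.1 * q.1.2.2
    then (((Real.sqrt 2 : ℝ) : ℂ))⁻¹ else 0

/-- The projection `P_α = |α⟩⟨α| ⊗ I ⊗ I` onto the `α`-sector of the bulk. -/
def proj15 (α : Fin 2) :
    Matrix (Fin 2 × Fin 2 × Fin 2) (Fin 2 × Fin 2 × Fin 2) ℂ :=
  Matrix.of fun x y => if x = y ∧ x.1 = α then 1 else 0

/-- The sector probability `p_α = Tr(P_α ρ)`. -/
noncomputable def p15 (ρ : Matrix (Fin 2 × Fin 2 × Fin 2) (Fin 2 × Fin 2 × Fin 2) ℂ)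
    (α : Fin 2) : ℝ :=
  ((proj15 α * ρ).trace).re

/-- Partial trace over the first and third qubits of a three-qubit operator. -/
noncomputable def ptrace13
    (m : Matrix (Fin 2 × Fin 2 × Fin 2) (Fin 2 × Fin 2 × Fin 2) ℂ) :
    Matrix (Fin 2) (Fin 2) ℂ :=
  Matrix.of fun i i' => ∑ a : Fin 2, ∑ j : Fin 2, m (a, i, j) (a, i', j)

/-- The reduced state `σ_α` on the second qubit of `P_α ρ P_α / p_α`. -/
noncomputable def σ15 (ρ : Matrix (Fin 2 × Fin 2 × Fin 2) (Fin 2 × Fin 2 × Fin 2) ℂ)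
    (α : Fin 2) : Matrix (Fin 2) (Fin 2) ℂ :=
  (p15 ρ α)⁻¹ • ptrace13 (proj15 α * ρ * proj15 α)

/-- The matrix `M α = ∑ j ⟨α,·,j|ρ|α,·,j⟩`. -/
noncomputable def blk (ρ : Matrix (Fin 2 × Fin 2 × Fin 2) (Fin 2 × Fin 2 × Fin 2) ℂ)
    (α : Fin 2) : Matrix (Fin 2) (Fin 2) ℂ :=
  ∑ j : Fin 2, ρ.submatrix (fun i => (α, i, j)) (fun i => (α, i, j))

theorem blk_posSemidef (ρ : Matrix (Fin 2 × Fin 2 × Fin 2) (Fin 2 × Fin 2 × Fin 2) ℂ)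
    (hρ : ρ.PosSemidef) (α : Fin 2) : (blk ρ α).PosSemidef := by
  unfold blk
  exact Matrix.posSemidef_sum _ fun j _ => hρ.submatrix _

theorem vnEntropy_of_diag {ι : Type*} [Fintype ι] [DecidableEq ι]
    (A W : Matrix ι ι ℂ) (d : ι → ℝ) (hW : W * Wᴴ = 1)
    (hA : A = W * Matrix.diagonal (fun i => (d i : ℂ)) * Wᴴ) :
    vnEntropy A = -∑ i, d i * Real.logb 2 (d i) := by
  have hD : (Matrix.diagonal (fun i => (d i : ℂ))).IsHermitian := by
    ext i j
    by_cases h : i = j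
    · subst h; simp
    · simp [Matrix.diagonal, h, Ne.symm h]
  have hH : A.IsHermitian := by
    rw [hA]; exact Matrix.isHermitian_mul_mul_conjTranspose W hD
  have hW' : Wᴴ * W = 1 := mul_eq_one_comm.mp hW
  have hc : A.charpoly = (Matrix.diagonal (fun i => (d i : ℂ))).charpoly := by
    rw [hA, Matrix.charpoly_mul_comm, ← Matrix.mul_assoc, hW', Matrix.one_mul]
  have hroots : (∏ i, (Polynomial.X - Polynomial.C (d i : ℂ))).roots =
      Multiset.map (fun i => (d i : ℂ)) Finset.univ.val := by
    rw [Polynomial.roots_prod]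
    · simp
    · simp [Finset.prod_ne_zero_iff, Polynomial.X_sub_C_ne_zero]
  have hr := hH.roots_charpoly_eq_eigenvalues
  rw [hc, Matrix.charpoly_diagonal, hroots] at hr
  have := congrArg (fun s : Multiset ℂ => (s.map (fun z : ℂ => z.re * Real.logb 2 z.re)).sum) hr
  simp only [Multiset.map_map] at this
  unfold vnEntropy
  rw [dif_pos hH]
  congr 1
  exact this.symm

theorem p15_eq (ρ : Matrix (Fin 2 × Fin 2 × Fin 2) (Fin 2 × Fin 2 × Fin 2) ℂ) (α : Fin 2) :
    p15 ρ α = ((blk ρ α).trace).re := by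
  unfold p15 blk proj15
  fin_cases α <;>
  simp [Matrix.trace, Matrix.mul_apply, Fintype.sum_prod_type, Fin.sum_univ_two]

theorem ptrace13_eq (ρ : Matrix (Fin 2 × Fin 2 × Fin 2) (Fin 2 × Fin 2 × Fin 2) ℂ) (α : Fin 2) :
    ptrace13 (proj15 α * ρ * proj15 α) = blk ρ α := by
  ext i k
  unfold ptrace13 blk proj15
  fin_cases α <;> fin_cases i <;> fin_cases k <;>
  simp [Matrix.mul_apply, Fintype.sum_prod_type, Fin.sum_univ_two]

set_option maxHeartbeats 2000000 in
theorem redA_eq (ρ : Matrix (Fin 2 × Fin 2 × Fin 2) (Fin 2 × Fin 2 × Fin 2) ℂ) 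
    (x y : Fin 2 × Fin 2 × Fin 2) :
    ptraceRight (V15 * ρ * V15ᴴ) x y =
      if x.1 = y.1 ∧ x.1 * x.2.2 = y.1 * y.2.2 then (1/2) * blk ρ x.1 x.2.1 y.2.1 else 0 := by
  have h2 : (((Real.sqrt 2 : ℝ) : ℂ))⁻¹ * (((Real.sqrt 2 : ℝ) : ℂ))⁻¹ = 1/2 := by
    rw [← mul_inv, ← Complex.ofReal_mul, Real.mul_self_sqrt (by norm_num)]; norm_num
  have hc : star (((Real.sqrt 2 : ℝ) : ℂ))⁻¹ = (((Real.sqrt 2 : ℝ) : ℂ))⁻¹ := by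
    simp [← Complex.ofReal_inv]
  have hV : ∀ (q : (Fin 2 × Fin 2 × Fin 2) × (Fin 2 × Fin 2 × Fin 2)) z, V15 q z =
      if z = (q.1.1, q.1.2.1, q.2.2.1) then
        (if q.2.1 = q.1.1 ∧ q.2.2.2 = q.1.1 * q.1.2.2 then (((Real.sqrt 2 : ℝ) : ℂ))⁻¹ else 0)
        else 0 := by
    rintro ⟨⟨a, i, b⟩, a', j, c⟩ ⟨z1, z2, z3⟩
    simp only [V15, Matrix.of_apply, Prod.mk.injEq]
    rw [← ite_and]
    refine if_congr ?_ rfl rfl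
    constructor
    · rintro ⟨rfl, rfl, rfl, rfl, rfl⟩; simp
    · rintro ⟨⟨rfl, rfl, rfl⟩, rfl, rfl⟩; simp
  generalize (((Real.sqrt 2 : ℝ) : ℂ))⁻¹ = s at h2 hV hc
  obtain ⟨a, i, b⟩ := x
  obtain ⟨a', i', b'⟩ := y
  simp only [ptraceRight, Matrix.of_apply, Matrix.mul_apply, Matrix.conjTranspose_apply, hV,
    apply_ite star, hc, star_zero, ite_mul, mul_ite, zero_mul, mul_zero,
    Finset.sum_ite_eq', Finset.mem_univ, if_true]
  simp only [Fintype.sum_prod_type]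
  have hs : ∀ r, s * r * s = 1 / 2 * r := fun r => by rw [← h2]; ring
  simp only [blk, Matrix.sum_apply, Matrix.submatrix_apply, hs]
  by_cases h : a = a'
  · subst h
    fin_cases a <;> fin_cases b <;> fin_cases b' <;> simp [Fin.sum_univ_two] <;> ring
  · fin_cases a <;> fin_cases a' <;> simp_all

/-- The Hadamard gate. -/
noncomputable def had : Matrix (Fin 2) (Fin 2) ℂ :=
  (((Real.sqrt 2 : ℝ) : ℂ))⁻¹ • !![1, 1; 1, -1]

theorem had_mul : had * hadᴴ = 1 := by
  have h2 : (((Real.sqrt 2 : ℝ) : ℂ))⁻¹ * (((Real.sqrt 2 : ℝ) : ℂ))⁻¹ = 1/2 := by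
    rw [← mul_inv, ← Complex.ofReal_mul, Real.mul_self_sqrt (by norm_num)]; norm_num
  ext i j
  fin_cases i <;> fin_cases j <;> simp [had, Matrix.mul_apply, Fin.sum_univ_two, h2] <;> norm_num

/-- The diagonalising unitary. -/
noncomputable def bigW (U : Fin 2 → Matrix (Fin 2) (Fin 2) ℂ) :
    Matrix (Fin 2 × Fin 2 × Fin 2) (Fin 2 × Fin 2 × Fin 2) ℂ :=
  Matrix.of fun x y => if x.1 = y.1 then U x.1 x.2.1 y.2.1 * had x.2.2 y.2.2 else 0

theorem bigW_conj (U : Fin 2 → Matrix (Fin 2) (Fin 2) ℂ) (e : Fin 2 × Fin 2 × Fin 2 → ℂ)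
    (x y : Fin 2 × Fin 2 × Fin 2) :
    (bigW U * Matrix.diagonal e * (bigW U)ᴴ) x y = if x.1 = y.1 then
      ∑ k, ∑ c, U x.1 x.2.1 k * star (U x.1 y.2.1 k) * (had x.2.2 c * star (had y.2.2 c)) *
        e (x.1, k, c) else 0 := by
  obtain ⟨a, i, b⟩ := x
  obtain ⟨a', i', b'⟩ := y
  rw [Matrix.mul_apply]
  simp only [Matrix.mul_diagonal, bigW, Matrix.of_apply, Matrix.conjTranspose_apply, 
    Fintype.sum_prod_type, apply_ite star, star_zero, star_mul', ite_mul, mul_ite, zero_mul,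
    mul_zero]
  split_ifs with h
  · subst h
    rw [Finset.sum_eq_single a]
    · simp only [if_true]
      refine Finset.sum_congr rfl fun k _ => Finset.sum_congr rfl fun c _ => ?_
      ring
    · intro z _ hz; simp [Ne.symm hz]
    · simp
  · refine Finset.sum_eq_zero fun z _ => ?_
    refine Finset.sum_eq_zero fun k _ => Finset.sum_eq_zero fun c _ => ?_
    by_cases h1 : a = z
    · subst h1; simp [Ne.symm h]
    · simp [h1]

/-- Eigenvalues of the reduced state. -/
noncomputable def bigd (d : Fin 2 → Fin 2 → ℝ) (x : Fin 2 × Fin 2 × Fin 2) : ℝ :=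
  if x.1 = 0 then (if x.2.2 = 0 then d 0 x.2.1 else 0) else d 1 x.2.1 / 2

theorem spec (M : Matrix (Fin 2) (Fin 2) ℂ) (hM : M.PosSemidef) :
    ∃ (U : Matrix (Fin 2) (Fin 2) ℂ) (d : Fin 2 → ℝ), U * Uᴴ = 1 ∧ (∀ k, 0 ≤ d k) ∧
      M = U * Matrix.diagonal (fun k => (d k : ℂ)) * Uᴴ := by
  refine ⟨hM.1.eigenvectorUnitary, hM.1.eigenvalues, ?_, hM.eigenvalues_nonneg, ?_⟩
  · exact Unitary.mul_star_self_of_mem hM.1.eigenvectorUnitary.2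
  · have := hM.1.spectral_theorem
    rw [Unitary.conjStarAlgAut_apply] at this
    exact this

theorem sector (M : Matrix (Fin 2) (Fin 2) ℂ) (U : Matrix (Fin 2) (Fin 2) ℂ) (d : Fin 2 → ℝ)
    (hU : U * Uᴴ = 1) (hd : ∀ k, 0 ≤ d k)
    (hM : M = U * Matrix.diagonal (fun k => (d k : ℂ)) * Uᴴ) (p : ℝ) (hp : p = M.trace.re) :
    p = d 0 + d 1 ∧ 
    -(p * Real.logb 2 p) + p * vnEntropy (p⁻¹ • M) =
      -(d 0 * Real.logb 2 (d 0) + d 1 * Real.logb 2 (d 1)) := by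
  have hpd : p = d 0 + d 1 := by
    rw [hp, hM, Matrix.trace_mul_comm, ← Matrix.mul_assoc, mul_eq_one_comm.mp hU, Matrix.one_mul,
      Matrix.trace_diagonal, Fin.sum_univ_two]
    simp
  refine ⟨hpd, ?_⟩
  have h0 := hd 0
  have h1 := hd 1
  rcases eq_or_ne p 0 with h | h
  · have e0 : d 0 = 0 := by linarith
    have e1 : d 1 = 0 := by linarith
    simp [h, e0, e1]
  · rw [vnEntropy_of_diag (p⁻¹ • M) U (fun k => d k / p) hU, Fin.sum_univ_two]
    · have key : ∀ k, p * (d k / p * Real.logb 2 (d k / p)) =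
          d k * Real.logb 2 (d k) - d k * Real.logb 2 p := by
        intro k
        rcases eq_or_ne (d k) 0 with hk | hk
        · simp [hk]
        · rw [Real.logb_div hk h]; field_simp
      have k0 := key 0
      have k1 := key 1
      have : p * Real.logb 2 p = d 0 * Real.logb 2 p + d 1 * Real.logb 2 p := by
        rw [← add_mul, ← hpd]
      linarith
    · have : Matrix.diagonal (fun k => ((d k / p : ℝ) : ℂ)) =
          p⁻¹ • Matrix.diagonal (fun k => (d k : ℂ)) := by
        ext i j
        by_cases hij : i = j
        · subst hij; simp; ring
        · simp [hij]
      rw [this, hM, Matrix.mul_smul, Matrix.smul_mul]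

/-- the full Ryu–Takayanagi formula `S_A = S_c + S_q + Tr(ρL)` with
area operator `L = |1⟩⟨1| ⊗ I ⊗ I`: for every density matrix `ρ` on three qubits,
`S(Tr_{4,5,6}(VρV†)) = -∑_α p_α log₂ p_α + ∑_α p_α S(σ_α) + p₁`. -/
theorem RT_formula_full_example
    (ρ : Matrix (Fin 2 × Fin 2 × Fin 2) (Fin 2 × Fin 2 × Fin 2) ℂ)
    (hρ : ρ.PosSemidef) (hρtr : ρ.trace = 1) :
    vnEntropy (ptraceRight (V15 * ρ * V15ᴴ)) =
      (-∑ α : Fin 2, p15 ρ α * Real.logb 2 (p15 ρ α)) +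
        (∑ α : Fin 2, p15 ρ α * vnEntropy (σ15 ρ α)) + p15 ρ 1 := by
  choose U d hU hd hM using fun α => spec (blk ρ α) (blk_posSemidef ρ hρ α)
  have hs := fun α => sector (blk ρ α) (U α) (d α) (hU α) (hd α) (hM α) (p15 ρ α) (p15_eq ρ α)
  have hσ : ∀ α, σ15 ρ α = (p15 ρ α)⁻¹ • blk ρ α := fun α => by rw [σ15, ptrace13_eq]
  have hW : bigW U * (bigW U)ᴴ = 1 := by
    have h1 : bigW U * (bigW U)ᴴ = bigW U * Matrix.diagonal (fun _ => 1) * (bigW U)ᴴ := by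
      rw [Matrix.diagonal_one, Matrix.mul_one]
    rw [h1]
    ext x y
    rw [bigW_conj]
    obtain ⟨a, i, b⟩ := x
    obtain ⟨a', i', b'⟩ := y
    by_cases h : a = a'
    · subst h
      have hu := congrFun (congrFun (hU a) i) i'
      have hh := congrFun (congrFun had_mul b) b'
      rw [Matrix.mul_apply] at hu hh
      simp only [Matrix.conjTranspose_apply] at hu hh
      simp only [if_true, mul_one]
      simp_rw [← Finset.mul_sum, hh, ← Finset.sum_mul, hu]
      simp only [Matrix.one_apply, Prod.mk.injEq, true_and]
      by_cases h1 : i = i' <;> by_cases h2 : b = b' <;> simp [h1, h2]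
    · simp [h]
  rw [vnEntropy_of_diag _ (bigW U) (bigd d) hW]
  · have a0 := (hs 0).2
    have a1 := (hs 1).2
    have b1 := (hs 1).1
    have key : ∀ k, d 1 k / 2 * Real.logb 2 (d 1 k / 2) =
        (d 1 k * Real.logb 2 (d 1 k) - d 1 k) / 2 := by
      intro k
      rcases eq_or_ne (d 1 k) 0 with hk | hk
      · simp [hk]
      · rw [Real.logb_div hk (by norm_num), Real.logb_self_eq_one (by norm_num)]; ring
    simp only [Fintype.sum_prod_type, Fin.sum_univ_two, bigd, hσ]
    simp [key]
    linarith
  · ext x y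
    rw [redA_eq, bigW_conj]
    obtain ⟨a, i, b⟩ := x
    obtain ⟨a', i', b'⟩ := y
    by_cases h : a = a'
    · subst h
      have h2 : (((Real.sqrt 2 : ℝ) : ℂ))⁻¹ * (((Real.sqrt 2 : ℝ) : ℂ))⁻¹ = 1/2 := by
        rw [← mul_inv, ← Complex.ofReal_mul, Real.mul_self_sqrt (by norm_num)]; norm_num
      have hm := congrFun (congrFun (hM a) i) i'
      rw [Matrix.mul_apply] at hm
      simp only [Matrix.mul_diagonal, Matrix.conjTranspose_apply, Fin.sum_univ_two] at hm
      simp only [hm]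
      fin_cases a <;> fin_cases b <;> fin_cases b' <;>
        simp [had, bigd, Fin.sum_univ_two, h2] <;> ring
    · simp [h]
end
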